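/- arXiv:1412.0361 — 3 statements merged into one kernel-verified Lean document; each statement's English description precedes it below -/
import Mathlib

section
/- Let g be a real Lie algebra with an integrable complex structure J (satisfying the Nijenhuis condition). Let g^l denote the l-th term of the descending central series and g^l(J) = g^l + J(g^l). Then [g^l(J), g^l(J)] ⊆ g^{l+1}(J) for all l ≥ 1. -/
/-- `g^l(J) = g^l + J(g^l)`, the smallest `J`-invariant subspace containing the `l`-th
term `g^l` of the descending central series (here `g^l` is
`LieModule.lowerCentralSeries ℝ g g (l-1)`, so that `g^1 = g`). -/
def glJ (g : Type*) [LieRing g] [LieAlgebra ℝ g] (J : g →ₗ[ℝ] g) (l : ℕ) :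
    Submodule ℝ g :=
  (LieModule.lowerCentralSeries ℝ g g (l - 1)).toSubmodule ⊔
    Submodule.map J (LieModule.lowerCentralSeries ℝ g g (l - 1)).toSubmodule

/-- (Salamon) If `J` is an integrable complex structure on a real Lie algebra `g`, then
`[g^l(J), g^l(J)] ⊆ g^{l+1}(J)` for all `l ≥ 1`. -/
theorem glJ_bracket_le_succ
    {g : Type*} [LieRing g] [LieAlgebra ℝ g] (J : g →ₗ[ℝ] g)
    (hJ2 : ∀ X : g, J (J X) = -X)
    (hNij : ∀ X Y : g, ⁅J X, J Y⁆ = ⁅X, Y⁆ + J ⁅J X, Y⁆ + J ⁅X, J Y⁆) :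
    ∀ l : ℕ, 1 ≤ l → ∀ X Y : g, X ∈ glJ g J l → Y ∈ glJ g J l →
      ⁅X, Y⁆ ∈ glJ g J (l + 1) := by
  intro l hl X Y hX hY
  obtain ⟨k, rfl⟩ : ∃ k, l = k + 1 := ⟨l - 1, by omega⟩
  simp only [glJ, Nat.add_sub_cancel] at hX hY ⊢
  have key : ∀ x y : g, y ∈ LieModule.lowerCentralSeries ℝ g g k →
      ⁅x, y⁆ ∈ LieModule.lowerCentralSeries ℝ g g (k + 1) := by
    intro x y hy
    rw [LieModule.lowerCentralSeries_succ]
    exact LieSubmodule.lie_mem_lie (LieSubmodule.mem_top x) hy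
  have key' : ∀ x y : g, x ∈ LieModule.lowerCentralSeries ℝ g g k →
      ⁅x, y⁆ ∈ LieModule.lowerCentralSeries ℝ g g (k + 1) := by
    intro x y hx
    rw [← lie_skew]
    exact neg_mem (key y x hx)
  obtain ⟨a, ha, _, ⟨b, hb, rfl⟩, rfl⟩ := Submodule.mem_sup.1 hX
  obtain ⟨c, hc, _, ⟨d, hd, rfl⟩, rfl⟩ := Submodule.mem_sup.1 hY
  refine Submodule.mem_sup.2 ⟨⁅a, c⁆ + ⁅a, J d⁆ + ⁅J b, c⁆ + ⁅b, d⁆,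
    add_mem (add_mem (add_mem (key _ _ hc) (key' _ _ ha)) (key _ _ hc)) (key _ _ hd),
    J (⁅J b, d⁆ + ⁅b, J d⁆),
    Submodule.mem_map_of_mem (add_mem (key _ _ hd) (key' _ _ hb)), ?_⟩
  simp only [add_lie, lie_add, hNij, map_add]
  abel
end

section
/- Let g be a real Lie algebra with an integrable complex structure J. Then for each l ≥ 2, the subspace g^l(J) = g^l + J(g^l) is a Lie subalgebra of g, and g^l(J) is an ideal in g^{l-1}(J). -/
/-- If `J` is an integrable complex structure on a real Lie algebra `g`, then for every
`l ≥ 2` the subspace `g^l(J)` is a Lie subalgebra of `g` and an ideal in `g^{l-1}(J)`. -/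
theorem glJ_subalgebra_and_ideal
    {g : Type*} [LieRing g] [LieAlgebra ℝ g] (J : g →ₗ[ℝ] g)
    (hJ2 : ∀ X : g, J (J X) = -X)
    (hNij : ∀ X Y : g, ⁅J X, J Y⁆ = ⁅X, Y⁆ + J ⁅J X, Y⁆ + J ⁅X, J Y⁆) :
    ∀ l : ℕ, 2 ≤ l →
      (∀ X Y : g, X ∈ glJ g J l → Y ∈ glJ g J l → ⁅X, Y⁆ ∈ glJ g J l) ∧
      (∀ X Y : g, X ∈ glJ g J (l - 1) → Y ∈ glJ g J l → ⁅X, Y⁆ ∈ glJ g J l) := by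
  intro l hl
  obtain ⟨n, rfl⟩ : ∃ n, l = n + 2 := ⟨l - 2, by omega⟩
  have hsucc : ∀ A B : g, B ∈ LieModule.lowerCentralSeries ℝ g g n →
      ⁅A, B⁆ ∈ LieModule.lowerCentralSeries ℝ g g (n + 1) := by
    intro A B hB
    rw [LieModule.lowerCentralSeries_succ]
    exact LieSubmodule.lie_mem_lie (LieSubmodule.mem_top A) hB
  have hsucc2 : ∀ A B : g, B ∈ LieModule.lowerCentralSeries ℝ g g n →
      ⁅B, A⁆ ∈ LieModule.lowerCentralSeries ℝ g g (n + 1) := by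
    intro A B hB
    rw [← lie_skew]
    exact neg_mem (hsucc A B hB)
  have hle : LieModule.lowerCentralSeries ℝ g g (n + 1) ≤
      LieModule.lowerCentralSeries ℝ g g n :=
    LieModule.antitone_lowerCentralSeries ℝ g g (Nat.le_succ n)
  have key : ∀ X Y : g, X ∈ glJ g J (n + 2 - 1) → Y ∈ glJ g J (n + 2) →
      ⁅X, Y⁆ ∈ glJ g J (n + 2) := by
    intro X Y hX hY
    have h1 : n + 2 - 1 - 1 = n := by omega
    have h2 : n + 2 - 1 = n + 1 := by omega
    unfold glJ at hX hY ⊢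
    rw [h1] at hX
    rw [h2] at hY ⊢
    obtain ⟨A, hA, _, ⟨B, hB, rfl⟩, rfl⟩ := Submodule.mem_sup.1 hX
    obtain ⟨C, hC, _, ⟨D, hD, rfl⟩, rfl⟩ := Submodule.mem_sup.1 hY
    have e : ⁅A + J B, C + J D⁆ =
        (⁅A, C + J D⁆ + ⁅J B, C⁆ + ⁅B, D⁆) + J (⁅J B, D⁆ + ⁅B, J D⁆) := by
      rw [add_lie, lie_add (J B), hNij, map_add]
      abel
    rw [e]
    refine Submodule.add_mem_sup ?_ (Submodule.mem_map_of_mem ?_)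
    · exact add_mem (add_mem (hsucc2 _ _ hA) (hsucc _ _ (hle hC))) (hsucc2 _ _ hB)
    · exact add_mem (hsucc _ _ (hle hD)) (hsucc2 _ _ hB)
  refine ⟨fun X Y hX hY => key X Y ?_ hY, key⟩
  have hle' : (LieModule.lowerCentralSeries ℝ g g (n + 1)).toSubmodule ≤
      (LieModule.lowerCentralSeries ℝ g g n).toSubmodule := hle
  exact sup_le_sup hle' (Submodule.map_mono hle') hX
end

section
/- Let g be a finite-dimensional nilpotent real Lie algebra admitting a nilpotent complex structure J (in particular this holds for an abelian complex structure). Then the nil-index satisfies s(g) ≤ (1/2) dim g. -/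
theorem aux_even_finrank {V : Type*} [AddCommGroup V] [Module ℝ V] [FiniteDimensional ℝ V]
    (f : V →ₗ[ℝ] V) (hf : ∀ x, f (f x) = -x) : Even (Module.finrank ℝ V) := by
  have h : f * f = (-1 : ℝ) • (LinearMap.id : V →ₗ[ℝ] V) := by
    ext x
    simp [hf]
  have h2 := congrArg LinearMap.det h
  rw [map_mul, LinearMap.det_smul, LinearMap.det_id, mul_one] at h2
  by_contra hn
  rw [Nat.not_even_iff_odd] at hn
  rw [hn.neg_one_pow] at h2
  nlinarith [mul_self_nonneg (LinearMap.det f)]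

theorem aux_even_sub {V : Type*} [AddCommGroup V] [Module ℝ V] [FiniteDimensional ℝ V]
    (f : V →ₗ[ℝ] V) (hf : ∀ x, f (f x) = -x) (W : Submodule ℝ V) :
    Even (Module.finrank ℝ (W ⊔ W.map f : Submodule ℝ V)) := by
  have hinv : ∀ x ∈ W ⊔ W.map f, f x ∈ W ⊔ W.map f := by
    intro x hx
    obtain ⟨y, hy, z, ⟨w, hw, rfl⟩, rfl⟩ := Submodule.mem_sup.1 hx
    rw [map_add, hf]
    exact add_mem (Submodule.mem_sup_right ⟨y, hy, rfl⟩)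
      (Submodule.mem_sup_left (neg_mem hw))
  refine aux_even_finrank (f.restrict hinv) ?_
  intro x
  ext
  simp [hf]

/-- If `g` is a finite-dimensional nilpotent real Lie algebra of nil-index `s`
(`g^s ≠ 0`, `g^{s+1} = 0`) endowed with a nilpotent complex structure `J` — an
integrable almost complex structure for which all inclusions
`g^{l+1}(J) ⊆ g^l(J)`, `1 ≤ l ≤ s`, are strict — then `s ≤ (1/2) dim g`. -/
theorem nilindex_le_half_dim_of_nilpotent_complex_structure
    {g : Type*} [LieRing g] [LieAlgebra ℝ g] [FiniteDimensional ℝ g]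
    (J : g →ₗ[ℝ] g)
    (hJ2 : ∀ X : g, J (J X) = -X)
    (hNij : ∀ X Y : g, ⁅J X, J Y⁆ = ⁅X, Y⁆ + J ⁅J X, Y⁆ + J ⁅X, J Y⁆)
    (s : ℕ) (hs1 : 1 ≤ s)
    (hs : LieModule.lowerCentralSeries ℝ g g (s - 1) ≠ ⊥)
    (hs' : LieModule.lowerCentralSeries ℝ g g s = ⊥)
    (hstrict : ∀ l : ℕ, 1 ≤ l → l ≤ s → glJ g J (l + 1) < glJ g J l) :
    2 * s ≤ Module.finrank ℝ g := by
  have key : ∀ k : ℕ, k ≤ s →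
      2 * k + Module.finrank ℝ (glJ g J (k + 1)) ≤ Module.finrank ℝ g := by
    intro k
    induction k with
    | zero =>
      intro _
      simpa using Submodule.finrank_le (glJ g J (0 + 1))
    | succ k ih =>
      intro hk
      have h1 := ih (by omega)
      have h2 := Submodule.finrank_lt_finrank_of_lt (hstrict (k + 1) (by omega) hk)
      have h3 : Even (Module.finrank ℝ (glJ g J (k + 1))) := aux_even_sub J hJ2 _
      have h4 : Even (Module.finrank ℝ (glJ g J (k + 1 + 1))) := aux_even_sub J hJ2 _
      rw [Nat.even_iff] at h3 h4
      omega
  have := key s le_rfl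
  omega
end
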